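/- Let G be a general (not necessarily bipartite) graph and H an EDCS(G, β, β⁻) with λ ≤ ε/32, β ≥ 8λ^{-2}·log(1/λ), β⁻ ≥ (1-λ)β, ε < 1/2. Then μ(G) ≤ (3/2 + ε)·μ(H). -/

import Mathlib

open SimpleGraph

/-- The degree of a vertex in a simple graph. -/
noncomputable def deg {V : Type*} (G : SimpleGraph V) (v : V) : ℕ := (G.neighborSet v).ncard

/-- The maximum matching size of a simple graph. -/
noncomputable def matchNum {V : Type*} (G : SimpleGraph V) : ℕ :=
  sSup {n | ∃ M : G.Subgraph, M.IsMatching ∧ M.edgeSet.ncard = n}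

section Matchings

variable {V : Type*} [Fintype V] {G : SimpleGraph V}

theorem two_mul_ncard_edgeSet_of_isMatching {M : G.Subgraph} (hM : M.IsMatching) :
    2 * M.edgeSet.ncard = M.verts.ncard := by
  classical
  have h := M.spanningCoe.sum_degrees_eq_twice_card_edges
  have hdeg : ∀ v, M.spanningCoe.degree v = if v ∈ M.verts then 1 else 0 := by
    intro v
    rw [Subgraph.degree_spanningCoe]
    split_ifs with hv
    · exact (Subgraph.isMatching_iff_forall_degree.1 hM) v hv
    · exact Subgraph.degree_of_notMem_verts hv
  simp only [hdeg, Finset.sum_boole, Nat.cast_id] at h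
  rw [Set.ncard_eq_toFinset_card' M.verts, Set.ncard_eq_toFinset_card' M.edgeSet]
  convert h.symm using 2
  · congr 1
    ext e
    simp
  · ext v
    simp

theorem bddAbove_matching_sizes :
    BddAbove {n | ∃ M : G.Subgraph, M.IsMatching ∧ M.edgeSet.ncard = n} := by
  refine ⟨Nat.card V, ?_⟩
  rintro n ⟨M, hM, rfl⟩
  have h := two_mul_ncard_edgeSet_of_isMatching hM
  have h' : M.verts.ncard ≤ Nat.card V := Set.ncard_le_card _
  omega

theorem ncard_verts_le_two_mul_matchNum {M : G.Subgraph} (hM : M.IsMatching) :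
    M.verts.ncard ≤ 2 * matchNum G := by
  rw [← two_mul_ncard_edgeSet_of_isMatching hM]
  exact Nat.mul_le_mul_left 2 (le_csSup bddAbove_matching_sizes ⟨M, hM, rfl⟩)

theorem exists_isMatching_ncard_verts_eq (G : SimpleGraph V) :
    ∃ M : G.Subgraph, M.IsMatching ∧ M.verts.ncard = 2 * matchNum G := by
  have hne : {n | ∃ M : G.Subgraph, M.IsMatching ∧ M.edgeSet.ncard = n}.Nonempty :=
    ⟨_, ⊥, fun v hv => hv.elim, rfl⟩
  obtain ⟨M, hM, h⟩ := Nat.sSup_mem hne bddAbove_matching_sizes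
  exact ⟨M, hM, by rw [← two_mul_ncard_edgeSet_of_isMatching hM, h]; rfl⟩

end Matchings

universe u

section TutteBerge

/-- The graph obtained from `H` by adding the vertices `κ`, adjacent to every other vertex. -/
def SimpleGraph.addUniversal {V : Type*} (H : SimpleGraph V) (κ : Type*) :
    SimpleGraph (V ⊕ κ) where
  Adj x y := x ≠ y ∧ ∀ a b, x = Sum.inl a → y = Sum.inl b → H.Adj a b
  symm := ⟨fun _ _ h => ⟨h.1.symm, fun a b ha hb => (h.2 b a hb ha).symm⟩⟩
  loopless := ⟨fun _ h => h.1 rfl⟩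

theorem card_eq_sum_connectedComponent_add_oddComponents {X : Type*} [Finite X]
    (K : SimpleGraph X) [Fintype K.ConnectedComponent] :
    Nat.card X = 2 * ∑ C : K.ConnectedComponent, C.supp.ncard / 2 + K.oddComponents.ncard := by
  classical
  have := Fintype.ofFinite X
  have h1 : Nat.card X = ∑ C : K.ConnectedComponent, C.supp.ncard := by
    rw [Nat.card_eq_fintype_card, ← Finset.card_univ,
      Finset.card_eq_sum_card_fiberwise (f := K.connectedComponentMk) (t := Finset.univ)
        (fun _ _ => Finset.mem_coe.2 (Finset.mem_univ _))]
    refine Finset.sum_congr rfl fun C _ => ?_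
    rw [Set.ncard_eq_toFinset_card']
    congr 1
    ext x
    simp
  have h2 : K.oddComponents.ncard = ∑ C : K.ConnectedComponent, C.supp.ncard % 2 := by
    rw [Set.ncard_eq_toFinset_card', Finset.card_eq_sum_ones]
    have : K.oddComponents.toFinset = Finset.univ.filter fun C => Odd C.supp.ncard := by
      ext C; simp
    rw [this, Finset.sum_filter]
    refine Finset.sum_congr rfl fun C _ => ?_
    split_ifs with h
    · exact (Nat.odd_iff.1 h).symm
    · exact (Nat.even_iff.1 (Nat.not_odd_iff_even.1 h)).symm
  rw [h1, h2, Finset.mul_sum, ← Finset.sum_add_distrib]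
  exact Finset.sum_congr rfl fun C _ => by omega

theorem card_le_of_addUniversal_isPerfectMatching {V κ : Type*} [Fintype V] [Fintype κ]
    {H : SimpleGraph V} {M : (H.addUniversal κ).Subgraph} (hM : M.IsPerfectMatching) :
    Fintype.card V ≤ 2 * matchNum H + Fintype.card κ := by
  classical
  let N : H.Subgraph :=
    { verts := {v | ∃ w, M.Adj (Sum.inl v) (Sum.inl w)}
      Adj := fun v w => M.Adj (Sum.inl v) (Sum.inl w)
      adj_sub := fun h => (M.adj_sub h).2 _ _ rfl rfl
      edge_vert := fun {v w} h => ⟨w, h⟩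
      symm := ⟨fun _ _ h => h.symm⟩ }
  have hN : N.IsMatching := by
    rintro v ⟨w, hw⟩
    exact ⟨w, hw, fun y hy => Sum.inl_injective (hM.1.eq_of_adj_left hy hw)⟩
  have h1 := ncard_verts_le_two_mul_matchNum hN
  have h2 : (N.vertsᶜ).ncard ≤ Fintype.card κ := by
    have hp : ∀ v : (N.vertsᶜ : Set V), ∃ i : κ, M.Adj (Sum.inl v) (Sum.inr i) := by
      rintro ⟨v, hv⟩
      obtain ⟨w, hw, -⟩ := hM.1 (hM.2 (Sum.inl v))
      rcases w with w | i
      · exact (hv ⟨w, hw⟩).elim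
      · exact ⟨i, hw⟩
    choose f hf using hp
    have hinj : Function.Injective f := by
      intro v w hvw
      have h := hf w
      rw [← hvw] at h
      exact Subtype.ext (Sum.inl_injective (hM.1.eq_of_adj_right (hf v) h))
    have := Nat.card_le_card_of_injective f hinj
    rwa [Nat.card_coe_set_eq, Nat.card_eq_fintype_card] at this
  have h3 := Set.ncard_add_ncard_compl N.verts
  rw [Nat.card_eq_fintype_card] at h3
  omega

/-- The nontrivial direction of the Tutte–Berge formula: the components of the graph obtained by
deleting `U` are recorded by the labelling `c`. -/
theorem exists_tutteBerge_witness {V : Type u} [Fintype V] [DecidableEq V] (H : SimpleGraph V) :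
    ∃ (U : Finset V) (ι : Type u) (_ : Fintype ι) (_ : DecidableEq ι) (c : V → ι),
      (∀ v w, H.Adj v w → v ∉ U → w ∉ U → c v = c w) ∧
      U.card + ∑ i, (Finset.univ.filter fun v => v ∉ U ∧ c v = i).card / 2 ≤ matchNum H := by
  classical
  by_cases hd : Fintype.card V ≤ 2 * matchNum H + 1
  · refine ⟨∅, ULift Unit, inferInstance, inferInstance, fun _ => ⟨()⟩, fun _ _ _ _ _ => rfl, ?_⟩
    simp
    omega
  obtain ⟨k, hk⟩ := Nat.exists_eq_add_of_le (by omega : 2 * matchNum H + 2 ≤ Fintype.card V)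
  have hno : ¬ ∃ M : (H.addUniversal (Fin k)).Subgraph, M.IsPerfectMatching := by
    rintro ⟨M, hM⟩
    have := card_le_of_addUniversal_isPerfectMatching hM
    rw [Fintype.card_fin] at this
    omega
  rw [tutte] at hno
  push Not at hno
  obtain ⟨u, hu⟩ := hno
  unfold IsTutteViolator at hu
  set D := (⊤ : (H.addUniversal (Fin k)).Subgraph).deleteVerts u with hD
  have hDv : ∀ x, x ∈ D.verts ↔ x ∉ u := by simp [hD]
  have hDadj : ∀ x y, x ∉ u → y ∉ u → (H.addUniversal (Fin k)).Adj x y → D.Adj x y := by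
    intro x y hx hy h
    simp [hD, hx, hy, h]
  have := Fintype.ofFinite D.coe.ConnectedComponent
  have hcount := card_eq_sum_connectedComponent_add_oddComponents D.coe
  have hcard : Nat.card D.verts + u.ncard = Fintype.card V + k := by
    have hc : D.verts = uᶜ := by ext x; simp [hDv]
    have h3 := Set.ncard_add_ncard_compl u
    rw [Nat.card_eq_fintype_card, Fintype.card_sum, Fintype.card_fin] at h3
    rw [hc, Nat.card_coe_set_eq]
    omega
  have hall : ∀ i : Fin k, (Sum.inr i : V ⊕ Fin k) ∈ u := by
    by_contra! h
    obtain ⟨i, hi⟩ := h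
    have hsub : Subsingleton D.coe.ConnectedComponent := by
      have key : ∀ C : D.coe.ConnectedComponent,
          C = D.coe.connectedComponentMk ⟨Sum.inr i, (hDv _).2 hi⟩ := by
        intro C
        induction C using ConnectedComponent.ind with
        | _ x =>
          by_cases hx : x = ⟨Sum.inr i, (hDv _).2 hi⟩
          · rw [hx]
          · refine ConnectedComponent.sound (Adj.reachable ?_)
            refine hDadj _ _ ((hDv _).1 x.2) hi ⟨fun h => hx (Subtype.ext h), ?_⟩
            rintro a b - h
            cases h
      exact ⟨fun C C' => (key C).trans (key C').symm⟩
    have h1 : D.coe.oddComponents.ncard ≤ 1 := Set.ncard_le_one_of_subsingleton _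
    omega
  let c : V → Option D.coe.ConnectedComponent := fun v =>
    if h : Sum.inl v ∈ D.verts then some (D.coe.connectedComponentMk ⟨Sum.inl v, h⟩) else none
  refine ⟨Finset.univ.filter fun v => Sum.inl v ∈ u, _, inferInstance, inferInstance, c, ?_, ?_⟩
  · intro v w hvw hv hw
    simp only [Finset.mem_filter, Finset.mem_univ, true_and] at hv hw
    simp only [c, dif_pos ((hDv _).2 hv), dif_pos ((hDv _).2 hw), Option.some.injEq]
    refine ConnectedComponent.sound (Adj.reachable ?_)
    refine hDadj _ _ hv hw ⟨fun h => hvw.ne (Sum.inl_injective h), ?_⟩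
    intro a b ha hb
    rwa [← Sum.inl_injective ha, ← Sum.inl_injective hb]
  · have hu' : u.ncard = (Finset.univ.filter fun v : V => Sum.inl v ∈ u).card + k := by
      rw [Set.ncard_eq_toFinset_card', ← Finset.card_toLeft_add_card_toRight]
      congr 1
      · congr 1
        ext v
        simp
      · have : u.toFinset.toRight = Finset.univ := by ext i; simp [hall]
        rw [this, Finset.card_univ, Fintype.card_fin]
    have hclass : ∀ C : D.coe.ConnectedComponent, (Finset.univ.filter fun v : V =>
        v ∉ (Finset.univ.filter fun v : V => Sum.inl v ∈ u) ∧ c v = some C).card =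
        C.supp.ncard := by
      intro C
      rw [← Set.ncard_coe_finset, ← Set.ncard_image_of_injective _ Subtype.val_injective,
        ← Set.ncard_image_of_injective _ (Sum.inl_injective (β := Fin k))]
      congr 1
      ext x
      rcases x with v | i
      · by_cases hv : Sum.inl v ∈ u
        · simp [hDv, hv]
        · simp [c, hDv, hv]
      · simp [hDv, hall]
    have hnone : (Finset.univ.filter fun v : V =>
        v ∉ (Finset.univ.filter fun v : V => Sum.inl v ∈ u) ∧ c v = none).card = 0 := by
      rw [Finset.card_eq_zero, Finset.filter_eq_empty_iff]
      rintro v -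
      simp [c, hDv]
    rw [Fintype.sum_option, hnone]
    simp only [hclass]
    omega

end TutteBerge

section DegreeBound

variable {V : Type*} [Fintype V] {H : SimpleGraph V}

theorem deg_eq_card_filter [DecidableRel H.Adj] (v : V) :
    deg H v = (Finset.univ.filter (H.Adj v)).card := by
  rw [deg, ← Set.ncard_coe_finset]
  congr 1
  ext w
  simp

/-- If adjacent vertices have degree sum at most `β`, then two sets of vertices span at most `β / 4`
edges per vertex between them. -/
theorem four_mul_sum_card_filter_adj_le [DecidableRel H.Adj] {β : ℕ}
    (hP1 : ∀ u v, H.Adj u v → deg H u + deg H v ≤ β) (A T : Finset V) :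
    4 * ∑ a ∈ A, (T.filter (H.Adj a)).card ≤ β * (A.card + T.card) := by
  set p : V → ℕ := fun a => (T.filter (H.Adj a)).card
  set q : V → ℕ := fun b => (A.filter fun a => H.Adj a b).card
  have hp : ∀ a, p a ≤ deg H a := fun a => by
    rw [deg_eq_card_filter]
    exact Finset.card_le_card (Finset.filter_subset_filter _ (Finset.subset_univ _))
  have hq : ∀ b, q b ≤ deg H b := fun b => by
    rw [deg_eq_card_filter]
    refine Finset.card_le_card fun a ha => ?_
    simp only [Finset.mem_filter, Finset.mem_univ, true_and] at ha ⊢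
    exact ha.2.symm
  have hpq : ∑ a ∈ A, p a = ∑ b ∈ T, q b :=
    Finset.sum_card_bipartiteAbove_eq_sum_card_bipartiteBelow _
  have hsq : ∑ a ∈ A, p a * p a + ∑ b ∈ T, q b * q b ≤ β * ∑ a ∈ A, p a := by
    have h1 : ∑ a ∈ A, p a * p a = ∑ a ∈ A, ∑ b ∈ T, if H.Adj a b then p a else 0 :=
      Finset.sum_congr rfl fun a _ => by rw [← Finset.sum_filter, Finset.sum_const, smul_eq_mul]
    have h2 : ∑ b ∈ T, q b * q b = ∑ a ∈ A, ∑ b ∈ T, if H.Adj a b then q b else 0 := by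
      rw [Finset.sum_comm]
      exact Finset.sum_congr rfl fun b _ => by
        rw [← Finset.sum_filter, Finset.sum_const, smul_eq_mul]
    have h3 : β * ∑ a ∈ A, p a = ∑ a ∈ A, ∑ b ∈ T, if H.Adj a b then β else 0 := by
      rw [Finset.mul_sum]
      exact Finset.sum_congr rfl fun a _ => by
        rw [← Finset.sum_filter, Finset.sum_const, smul_eq_mul, mul_comm]
    rw [h1, h2, h3, ← Finset.sum_add_distrib]
    refine Finset.sum_le_sum fun a _ => ?_
    rw [← Finset.sum_add_distrib]
    refine Finset.sum_le_sum fun b _ => ?_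
    split_ifs with hab
    · exact (add_le_add (hp a) (hq b)).trans (hP1 a b hab)
    · rfl
  have hpoint : ∀ x : ℕ, 4 * (β * x) ≤ 4 * (x * x) + β * β := by
    intro x
    zify
    nlinarith [sq_nonneg (2 * (x : ℤ) - β)]
  have hA := Finset.sum_le_sum fun a (_ : a ∈ A) => hpoint (p a)
  have hT := Finset.sum_le_sum fun b (_ : b ∈ T) => hpoint (q b)
  simp only [Finset.sum_add_distrib, ← Finset.mul_sum, Finset.sum_const, smul_eq_mul] at hA hT
  rw [← hpq] at hT
  rcases Nat.eq_zero_or_pos β with h0 | hpos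
  · have : ∀ a ∈ A, p a = 0 := by
      intro a _
      by_contra h
      obtain ⟨b, hb⟩ := Finset.card_pos.1 (Nat.pos_of_ne_zero h)
      have h1 := hP1 a b (Finset.mem_filter.1 hb).2
      have h2 := hp a
      omega
    simp [Finset.sum_eq_zero this]
  · refine Nat.le_of_mul_le_mul_left ?_ hpos
    nlinarith

end DegreeBound

theorem even_card_of_involution {α : Type*} (s : Finset α) (f : α → α)
    (hmem : ∀ a ∈ s, f a ∈ s) (hne : ∀ a ∈ s, f a ≠ a) (hinv : ∀ a ∈ s, f (f a) = a) :
    Even s.card := by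
  have h : ∑ _a ∈ s, (1 : ZMod 2) = 0 :=
    Finset.sum_involution (fun a _ => f a) (fun _ _ => by decide) (fun a ha _ => hne a ha)
      hmem hinv
  rw [Finset.sum_const, nsmul_eq_mul, mul_one] at h
  exact (ZMod.natCast_eq_zero_iff_even).1 h

theorem exists_involution_of_isMatching {V : Type*} {G : SimpleGraph V} {M : G.Subgraph}
    (hM : M.IsMatching) :
    ∃ f : V → V, ∀ v ∈ M.verts, f v ∈ M.verts ∧ G.Adj v (f v) ∧ f (f v) = v := by
  classical
  choose! f hf using fun v (hv : v ∈ M.verts) => (hM hv).exists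
  refine ⟨f, fun v hv => ?_⟩
  have hfv := (hf v hv).snd_mem
  exact ⟨hfv, (hf v hv).adj_sub, hM.eq_of_adj_left (hf _ hfv) (hf v hv).symm⟩

/-- EDCS lemma for general graphs: if `H` is an EDCS(`G`, `β`, `β⁻`) with `ε < 1/2`,
`λ ≤ ε/32`, `β ≥ 8·λ⁻²·log(1/λ)`, `β⁻ ≥ (1-λ)β`, then `μ(G) ≤ (3/2 + ε)·μ(H)`. -/
theorem stmt11 {V : Type*} [Fintype V] (G H : SimpleGraph V) (hHG : H ≤ G)
    (ε lam : ℝ) (β βm : ℕ)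
    (hε0 : 0 < ε) (hε : ε < 1/2) (hlam0 : 0 < lam) (hlam : lam ≤ ε/32)
    (hβ : 8 / lam ^ 2 * Real.log (1 / lam) ≤ (β : ℝ)) (hβm : (1 - lam) * β ≤ (βm : ℝ))
    (hP1 : ∀ u v, H.Adj u v → deg H u + deg H v ≤ β)
    (hP2 : ∀ u v, G.Adj u v → ¬ H.Adj u v → βm ≤ deg H u + deg H v) :
    (matchNum G : ℝ) ≤ (3/2 + ε) * matchNum H := by
  classical
  have hlamβ : 1 ≤ lam * (lam * β) := by
    have hlog : 1 - lam ≤ Real.log (1 / lam) := by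
      have := Real.one_sub_inv_le_log_of_pos (one_div_pos.2 hlam0)
      simpa using this
    have h1 : 8 / lam ^ 2 * (1 - lam) ≤ β :=
      (mul_le_mul_of_nonneg_left hlog (by positivity)).trans hβ
    rw [div_mul_eq_mul_div, div_le_iff₀ (by positivity)] at h1
    nlinarith
  have hβ0 : (0 : ℝ) < β := by
    by_contra h
    have h0 : (β : ℝ) = 0 := le_antisymm (not_lt.1 h) (Nat.cast_nonneg _)
    rw [h0] at hlamβ
    norm_num at hlamβ
  obtain ⟨M, hM, hMcard⟩ := exists_isMatching_ncard_verts_eq G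
  obtain ⟨f, hf⟩ := exists_involution_of_isMatching hM
  obtain ⟨U, ι, _, _, c, hc, hU⟩ := exists_tutteBerge_witness H
  set k : ι → ℕ := fun i => (Finset.univ.filter fun v => v ∉ U ∧ c v = i).card with hk
  let big : ι → Prop := fun i => lam * β < k i
  set S : Finset V := M.verts.toFinset
  replace hf : ∀ v ∈ S, f v ∈ S ∧ G.Adj v (f v) ∧ f (f v) = v := by simpa [S] using hf
  have hS : S.card = 2 * matchNum G := by rw [← hMcard, Set.ncard_eq_toFinset_card']
  have hinj : Set.InjOn f S := fun v hv w hw h => by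
    rw [← (hf v hv).2.2, h, (hf w hw).2.2]
  set W : Finset V := Finset.univ.filter fun v => v ∉ U ∧ big (c v)
  set I : Finset V := S.filter fun v => (v ∉ U ∧ ¬ big (c v)) ∧ f v ∉ U ∧ c (f v) = c v
  set N : Finset V := S.filter fun v => (v ∉ U ∧ ¬ big (c v)) ∧ f v ∉ U ∧ c (f v) ≠ c v
  set P : Finset V := S.filter fun v => f v ∈ U
  have hPU : P.card ≤ U.card :=
    Finset.card_le_card_of_injOn f (fun v hv => (Finset.mem_filter.1 hv).2)
      (hinj.mono fun v hv => (Finset.mem_filter.1 hv).1)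
  have hSle : S.card ≤ U.card + W.card + U.card + I.card + N.card := by
    have hsub : S ⊆ U ∪ W ∪ P ∪ I ∪ N := by
      intro v hv
      simp only [W, P, I, N, Finset.mem_union, Finset.mem_filter, Finset.mem_univ, true_and, hv]
      tauto
    have h := Finset.card_le_card hsub
    have h1 := Finset.card_union_le (U ∪ W ∪ P ∪ I) N
    have h2 := Finset.card_union_le (U ∪ W ∪ P) I
    have h3 := Finset.card_union_le (U ∪ W) P
    have h4 := Finset.card_union_le U W
    omega
  have hWI : (1 - lam) * W.card + I.card ≤ 2 * ((∑ i, k i / 2 : ℕ) : ℝ) := by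
    rw [Finset.card_eq_sum_card_fiberwise (f := c) (s := W) (t := Finset.univ)
        (fun _ _ => Finset.mem_coe.2 (Finset.mem_univ _)),
      Finset.card_eq_sum_card_fiberwise (f := c) (s := I) (t := Finset.univ)
        (fun _ _ => Finset.mem_coe.2 (Finset.mem_univ _))]
    push_cast
    rw [Finset.mul_sum, Finset.mul_sum, ← Finset.sum_add_distrib]
    refine Finset.sum_le_sum fun i _ => ?_
    by_cases hi : big i
    · have hW : (W.filter fun v => c v = i).card ≤ k i := by
        refine Finset.card_le_card fun v hv => ?_
        simp only [W, Finset.mem_filter, Finset.mem_univ, true_and] at hv ⊢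
        exact ⟨hv.1.1, hv.2⟩
      have hI : (I.filter fun v => c v = i) = ∅ := by
        refine Finset.filter_eq_empty_iff.2 fun v hv h => ?_
        rw [← h] at hi
        exact (Finset.mem_filter.1 hv).2.1.2 hi
      have h1 : k i ≤ 2 * (k i / 2) + 1 := by omega
      have h1' : (k i : ℝ) ≤ 2 * ((k i / 2 : ℕ) : ℝ) + 1 := by exact_mod_cast h1
      have h2 : 1 ≤ lam * k i :=
        hlamβ.trans (mul_le_mul_of_nonneg_left hi.le hlam0.le)
      have h3 : ((W.filter fun v => c v = i).card : ℝ) ≤ k i := by exact_mod_cast hW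
      rw [hI, Finset.card_empty]
      have h4 : (1 - lam) * ((W.filter fun v => c v = i).card : ℝ) ≤ (1 - lam) * k i :=
        mul_le_mul_of_nonneg_left h3 (by linarith)
      push_cast
      linarith
    · have hW : (W.filter fun v => c v = i) = ∅ := by
        refine Finset.filter_eq_empty_iff.2 fun v hv h => hi ?_
        rw [← h]
        exact (Finset.mem_filter.1 hv).2.2
      have hI : (I.filter fun v => c v = i).card ≤ k i := by
        refine Finset.card_le_card fun v hv => ?_
        simp only [I, Finset.mem_filter, Finset.mem_univ, true_and] at hv ⊢
        exact ⟨hv.1.2.1.1, hv.2⟩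
      have heven : Even (I.filter fun v => c v = i).card := by
        refine even_card_of_involution _ f (fun v hv => ?_) (fun v hv => ?_) (fun v hv => ?_)
        · simp only [I, Finset.mem_filter] at hv ⊢
          obtain ⟨⟨hvS, ⟨hvU, hvb⟩, hfU, hcf⟩, hvi⟩ := hv
          obtain ⟨h1, -, h3⟩ := hf v hvS
          rw [h3, hcf]
          exact ⟨⟨h1, ⟨hfU, hvb⟩, hvU, rfl⟩, hvi⟩
        · simp only [I, Finset.mem_filter] at hv
          exact (hf v hv.1.1).2.1.ne'
        · simp only [I, Finset.mem_filter] at hv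
          exact (hf v hv.1.1).2.2
      have h1 : (I.filter fun v => c v = i).card ≤ 2 * (k i / 2) := by
        obtain ⟨r, hr⟩ := heven
        omega
      rw [hW, Finset.card_empty]
      have h2 : ((I.filter fun v => c v = i).card : ℝ) ≤ 2 * ((k i / 2 : ℕ) : ℝ) := by
        exact_mod_cast h1
      push_cast at h2 ⊢
      linarith
  have hdeg : ∀ v, v ∉ U → ¬ big (c v) →
      (deg H v : ℝ) ≤ (U.filter (H.Adj v)).card + lam * β := by
    intro v hv hb
    have hsub : Finset.univ.filter (H.Adj v) ⊆
        U.filter (H.Adj v) ∪ Finset.univ.filter fun w => w ∉ U ∧ c w = c v := by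
      intro w hw
      have hw' := (Finset.mem_filter.1 hw).2
      by_cases hwU : w ∈ U
      · simp [hwU, hw']
      · simp [hwU, (hc v w hw' hv hwU).symm]
    have h := (Finset.card_le_card hsub).trans (Finset.card_union_le _ _)
    rw [← deg_eq_card_filter] at h
    have h' : (deg H v : ℝ) ≤ (U.filter (H.Adj v)).card + k (c v) := by exact_mod_cast h
    have hb' : (k (c v) : ℝ) ≤ lam * β := not_lt.1 hb
    linarith
  have hdeg' : ∀ v, v ∉ U → (deg H v : ℝ) ≤ ((U ∪ W).filter (H.Adj v)).card + lam * β := by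
    intro v hv
    by_cases hb : big (c v)
    · have hsub : Finset.univ.filter (H.Adj v) ⊆ (U ∪ W).filter (H.Adj v) := by
        intro w hw
        have hw' := (Finset.mem_filter.1 hw).2
        by_cases hwU : w ∈ U
        · simp [hwU, hw']
        · simp [W, hwU, hw', ← hc v w hw' hv hwU, hb]
      have h := Finset.card_le_card hsub
      rw [← deg_eq_card_filter] at h
      have h' : (deg H v : ℝ) ≤ ((U ∪ W).filter (H.Adj v)).card := by exact_mod_cast h
      have : 0 ≤ lam * β := by positivity
      linarith
    · refine (hdeg v hv hb).trans (add_le_add_left ?_ _)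
      exact_mod_cast Finset.card_le_card
        (Finset.filter_subset_filter _ Finset.subset_union_left)
  have hE1 := four_mul_sum_card_filter_adj_le hP1 N U
  have hE2 := four_mul_sum_card_filter_adj_le hP1 (N.image f) (U ∪ W)
  have hinjN : Set.InjOn f N := hinj.mono fun v hv => (Finset.mem_filter.1 hv).1
  rw [Finset.sum_image hinjN, Finset.card_image_of_injOn hinjN] at hE2
  have hE : N.card * ((1 - 3 * lam) * β) ≤ ((∑ v ∈ N, (U.filter (H.Adj v)).card : ℕ) : ℝ) +
      ((∑ v ∈ N, ((U ∪ W).filter (H.Adj (f v))).card : ℕ) : ℝ) := by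
    push_cast
    rw [← Finset.sum_add_distrib, ← nsmul_eq_mul, ← Finset.sum_const]
    refine Finset.sum_le_sum fun v hv => ?_
    obtain ⟨hvS, ⟨hvU, hvb⟩, hfU, hcf⟩ := Finset.mem_filter.1 hv
    have h1 := hP2 v (f v) (hf v hvS).2.1 fun h => hcf (hc _ _ h hvU hfU).symm
    have h1' : (βm : ℝ) ≤ deg H v + deg H (f v) := by exact_mod_cast h1
    have h2 := hdeg v hvU hvb
    have h3 := hdeg' (f v) hfU
    linarith
  have hUW := Finset.card_union_le U W
  have hE1' : 4 * ((∑ v ∈ N, (U.filter (H.Adj v)).card : ℕ) : ℝ) ≤ β * (N.card + U.card) := by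
    exact_mod_cast hE1
  have hE2' : 4 * ((∑ v ∈ N, ((U ∪ W).filter (H.Adj (f v))).card : ℕ) : ℝ) ≤
      β * (N.card + (U.card + W.card)) := by
    exact_mod_cast hE2.trans (Nat.mul_le_mul_left _ (Nat.add_le_add_left hUW _))
  have hN : (N.card : ℝ) * (2 - 12 * lam) ≤ 2 * U.card + W.card := by
    refine le_of_mul_le_mul_left ?_ hβ0
    linarith
  have hN' : (N.card : ℝ) ≤ (1 / 2 + 4 * lam) * (2 * U.card + W.card) := by
    have hmul := mul_le_mul_of_nonneg_left hN (by linarith : 0 ≤ 1 / 2 + 4 * lam)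
    have h1 : 1 ≤ (1 / 2 + 4 * lam) * (2 - 12 * lam) := by nlinarith
    have h2 := mul_le_mul_of_nonneg_left h1 (Nat.cast_nonneg (α := ℝ) N.card)
    linarith
  have hU' : (U.card : ℝ) + ((∑ i, k i / 2 : ℕ) : ℝ) ≤ matchNum H := by exact_mod_cast hU
  have hS' : 2 * (matchNum G : ℝ) ≤ U.card + W.card + U.card + I.card + N.card := by
    exact_mod_cast hS ▸ hSle
  have hu0 : (0 : ℝ) ≤ lam * U.card := by positivity
  have hH : (1 - lam) * (2 * U.card + W.card) + I.card ≤ 2 * (matchNum H : ℝ) := by linarith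
  have hmul := mul_le_mul_of_nonneg_left hH (by linarith : 0 ≤ 3 / 2 + ε)
  have hcoef : 3 / 2 + 4 * lam ≤ (3 / 2 + ε) * (1 - lam) := by nlinarith
  have ht : (0 : ℝ) ≤ 2 * U.card + W.card := by positivity
  have hcoef' := mul_le_mul_of_nonneg_right hcoef ht
  have hI0 : (0 : ℝ) ≤ (1 / 2 + ε) * I.card := by positivity
  linarith
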